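/- arXiv:2312.13153 — 2 statements merged into one kernel-verified Lean document; each statement's English description precedes it below -/
import Mathlib

section
/- For any class A of measure-preserving systems, the class M(A⊥) of multipliers of A⊥ is closed under taking factors: if T ∈ M(A⊥) and S is a factor of T, then S ∈ M(A⊥). -/
open MeasureTheory

/-- A measure-preserving system: an automorphism of a standard Borel probability
space. -/
structure MPS where
  X : Type
  mX : MeasurableSpace X
  sb : @StandardBorelSpace X mX
  μ : @Measure X mX
  T : X → X
  prob : @IsProbabilityMeasure X mX μ
  mp : @MeasurePreserving X X mX mX T μ μ

attribute [instance] MPS.mX MPS.sb MPS.prob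

/-- `lam` is a joining of the systems `S₁` and `S₂`. -/
def MPS.IsJoining (S₁ S₂ : MPS) (lam : Measure (S₁.X × S₂.X)) : Prop :=
  IsProbabilityMeasure lam ∧ MeasurePreserving (Prod.map S₁.T S₂.T) lam lam ∧
    lam.map Prod.fst = S₁.μ ∧ lam.map Prod.snd = S₂.μ

/-- Two systems are disjoint if their only joining is the product measure. -/
def MPS.Disj (S₁ S₂ : MPS) : Prop :=
  ∀ lam : Measure (S₁.X × S₂.X), S₁.IsJoining S₂ lam → lam = S₁.μ.prod S₂.μ

/-- The class `A⊥` of systems disjoint from every member of `A`. -/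
def MPS.perp (A : Set MPS) : Set MPS := {S | ∀ S' ∈ A, S.Disj S'}

/-- The system determined by a joining of two systems. -/
def MPS.joinSys (S₁ S₂ : MPS) (lam : Measure (S₁.X × S₂.X))
    (h : S₁.IsJoining S₂ lam) : MPS :=
  ⟨S₁.X × S₂.X, inferInstance, inferInstance, lam, Prod.map S₁.T S₂.T, h.1, h.2.1⟩

/-- `S` is a multiplier of `A⊥`: it belongs to `A⊥` and every joining of `S` with a
member of `A⊥` yields again a member of `A⊥`. -/
def MPS.IsMultiplier (A : Set MPS) (S : MPS) : Prop :=
  S ∈ MPS.perp A ∧ ∀ S' ∈ MPS.perp A, ∀ lam, ∀ h : S.IsJoining S' lam,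
    S.joinSys S' lam h ∈ MPS.perp A

/-- `lam` is an `n`-fold self-joining of `S`. -/
def MPS.IsSelfJoining (S : MPS) (n : ℕ) (lam : Measure (Fin n → S.X)) : Prop :=
  IsProbabilityMeasure lam ∧ MeasurePreserving (fun x i => S.T (x i)) lam lam ∧
    ∀ i, lam.map (fun x => x i) = S.μ

/-- The system determined by an `n`-fold self-joining of `S`. -/
def MPS.selfJoinSys (S : MPS) (n : ℕ) (lam : Measure (Fin n → S.X))
    (h : S.IsSelfJoining n lam) : MPS :=
  ⟨Fin n → S.X, inferInstance, inferInstance, lam, fun x i => S.T (x i), h.1, h.2.1⟩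

/-- Isomorphism of measure-preserving systems. -/
def MPS.Isomorphic (S₁ S₂ : MPS) : Prop :=
  ∃ e : S₁.X ≃ S₂.X, Measurable e ∧ Measurable e.symm ∧
    MeasurePreserving e S₁.μ S₂.μ ∧
    (fun x => S₂.T (e x)) =ᵐ[S₁.μ] (fun x => e (S₁.T x))

/-- `S₂` is a factor of `S₁`. -/
def MPS.IsFactor (S₁ S₂ : MPS) : Prop :=
  ∃ F : S₁.X → S₂.X, MeasurePreserving F S₁.μ S₂.μ ∧
    (fun x => F (S₁.T x)) =ᵐ[S₁.μ] (fun x => S₂.T (F x))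

open Filter Topology ProbabilityTheory
open scoped ENNReal BoundedContinuousFunction

/-- A measurable map on a Polish space becomes continuous after refining the topology. -/
lemma exists_polish_refinement.{u, v} {X : Type u} {W : Type v} [mX : MeasurableSpace X]
    [tX : TopologicalSpace X] [hX : PolishSpace X] [hXb : BorelSpace X] [MeasurableSpace W]
    [TopologicalSpace W] [SecondCountableTopology W] [OpensMeasurableSpace W]
    {f : X → W} (hf : Measurable f) :
    ∃ (X' : Type u) (_ : MeasurableSpace X') (_ : TopologicalSpace X') (_ : PolishSpace X')
      (_ : BorelSpace X') (e : X' ≃ᵐ X), Continuous e ∧ Continuous (f ∘ e) := by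
  obtain ⟨t', hle, hcont, hpol⟩ := hf.exists_continuous
  have hb : @BorelSpace X t' mX := by
    refine @BorelSpace.mk X t' mX ?_
    rw [hXb.measurable_eq]
    exact (borel_eq_borel_of_le hpol hX hle).symm
  exact ⟨X, mX, t', hpol, hb, MeasurableEquiv.refl X, continuous_id_iff_le.2 hle, hcont⟩

/-- The averages of the first `n + 1` images of a measure under the iterates of a map. -/
noncomputable def cesaroMeasure {P : Type*} [MeasurableSpace P] (g : P → P) (lam : Measure P)
    (n : ℕ) : Measure P :=
  ((n : ℝ≥0∞) + 1)⁻¹ • ∑ k ∈ Finset.range (n + 1), lam.map g^[k]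

lemma map_cesaroMeasure {P W : Type*} [MeasurableSpace P] [MeasurableSpace W] {g : P → P}
    {lam : Measure P} {h : P → W} (hh : Measurable h) {κ : Measure W}
    (hκ : ∀ k, (lam.map g^[k]).map h = κ) (n : ℕ) :
    (cesaroMeasure g lam n).map h = κ := by
  rw [cesaroMeasure, Measure.map_smul, Measure.map_finset_sum hh.aemeasurable]
  simp only [hκ, Finset.sum_const, Finset.card_range]
  rw [← Nat.cast_smul_eq_nsmul ℝ≥0∞, smul_smul, Nat.cast_add, Nat.cast_one,
    ENNReal.inv_mul_cancel (by simp) (by finiteness), one_smul]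

lemma isProbabilityMeasure_cesaroMeasure {P : Type*} [MeasurableSpace P] {g : P → P}
    (hg : Measurable g) {lam : Measure P} [IsProbabilityMeasure lam] (n : ℕ) :
    IsProbabilityMeasure (cesaroMeasure g lam n) := by
  have h (k : ℕ) : IsProbabilityMeasure (lam.map g^[k]) :=
    Measure.isProbabilityMeasure_map (hg.iterate k).aemeasurable
  constructor
  simp only [cesaroMeasure, Measure.smul_apply, Measure.finsetSum_apply, measure_univ,
    Finset.sum_const, Finset.card_range, nsmul_eq_mul, mul_one, smul_eq_mul, Nat.cast_add,
    Nat.cast_one]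
  exact ENNReal.inv_mul_cancel (by simp) (by finiteness)

lemma integral_cesaroMeasure {P : Type*} [MeasurableSpace P] {g : P → P}
    (hg : Measurable g) {lam : Measure P} [IsProbabilityMeasure lam] {f : P → ℝ}
    (hf : Measurable f) {C : ℝ} (hC : ∀ x, |f x| ≤ C) (n : ℕ) :
    ∫ x, f x ∂(cesaroMeasure g lam n) =
      ((n : ℝ) + 1)⁻¹ * ∑ k ∈ Finset.range (n + 1), ∫ x, f (g^[k] x) ∂lam := by
  have h (k : ℕ) : IsProbabilityMeasure (lam.map g^[k]) :=
    Measure.isProbabilityMeasure_map (hg.iterate k).aemeasurable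
  rw [cesaroMeasure, integral_smul_measure, integral_finsetSum_measure]
  · rw [smul_eq_mul, ENNReal.toReal_inv, ENNReal.toReal_add (by finiteness) (by finiteness)]
    simp only [ENNReal.toReal_natCast, ENNReal.toReal_one]
    congr 1
    refine Finset.sum_congr rfl fun k _ ↦ ?_
    rw [integral_map (hg.iterate k).aemeasurable hf.aestronglyMeasurable]
  · exact fun k _ ↦ Integrable.of_bound hf.aestronglyMeasurable C (Eventually.of_forall hC)

/-- Cesàro averages are asymptotically invariant. -/
lemma tendsto_integral_cesaroMeasure_sub {P : Type*} [MeasurableSpace P] {g : P → P}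
    (hg : Measurable g) {lam : Measure P} [IsProbabilityMeasure lam] {f : P → ℝ}
    (hf : Measurable f) {C : ℝ} (hC : ∀ x, |f x| ≤ C) :
    Tendsto (fun n ↦ ∫ x, f (g x) ∂(cesaroMeasure g lam n) - ∫ x, f x ∂(cesaroMeasure g lam n))
      atTop (𝓝 0) := by
  have hI (k : ℕ) : |∫ x, f (g^[k] x) ∂lam| ≤ C := by
    simpa using norm_integral_le_of_norm_le_const (μ := lam) (f := fun x ↦ f (g^[k] x))
      (Eventually.of_forall fun x ↦ hC (g^[k] x))
  have key (n : ℕ) : ∫ x, f (g x) ∂(cesaroMeasure g lam n) - ∫ x, f x ∂(cesaroMeasure g lam n) =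
      ((n : ℝ) + 1)⁻¹ * (∫ x, f (g^[n + 1] x) ∂lam - ∫ x, f (g^[0] x) ∂lam) := by
    rw [integral_cesaroMeasure hg (f := fun x ↦ f (g x)) (hf.comp hg) (fun x ↦ hC (g x)),
      integral_cesaroMeasure hg hf hC, ← mul_sub, ← Finset.sum_sub_distrib]
    simp only [← Function.iterate_succ_apply' g]
    rw [Finset.sum_range_sub (fun k ↦ ∫ x, f (g^[k] x) ∂lam)]
  simp only [key]
  have h0 : Tendsto (fun n : ℕ ↦ ((n : ℝ) + 1)⁻¹) atTop (𝓝 0) := by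
    simpa using tendsto_one_div_add_atTop_nhds_zero_nat (𝕜 := ℝ)
  refine h0.zero_mul_isBoundedUnder_le ⟨C + C, ?_⟩
  simp only [eventually_map]
  exact Eventually.of_forall fun n ↦ (abs_sub _ _).trans (add_le_add (hI _) (hI _))

/-- If the Cesàro averages of `lam` under `g` are tight, then a subnet of them converges to a
measure that is invariant as seen through a map `i` for which `i` and `i ∘ g` are continuous. -/
lemma exists_tendsto_cesaroMeasure {P Q : Type*} [MeasurableSpace P] [TopologicalSpace P]
    [T2Space P] [BorelSpace P] [MeasurableSpace Q] [TopologicalSpace Q]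
    [BorelSpace Q] [HasOuterApproxClosed Q] {g : P → P} (hg : Measurable g)
    (lam : Measure P) [IsProbabilityMeasure lam] {i : P → Q} (hi : Continuous i)
    (hig : Continuous (i ∘ g)) (htight : IsTightMeasureSet (Set.range (cesaroMeasure g lam))) :
    ∃ (ν : ProbabilityMeasure P) (c : ℕ → ProbabilityMeasure P) (U : Ultrafilter ℕ),
      (∀ n, (c n : Measure P) = cesaroMeasure g lam n) ∧ Tendsto c U (𝓝 ν) ∧
      (ν : Measure P).map (i ∘ g) = (ν : Measure P).map i := by
  let c (n : ℕ) : ProbabilityMeasure P :=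
    ⟨cesaroMeasure g lam n, isProbabilityMeasure_cesaroMeasure hg n⟩
  have hcomp : IsCompact (closure (Set.range c)) := by
    refine isCompact_closure_of_isTightMeasureSet (htight.subset ?_)
    rintro _ ⟨_, ⟨n, rfl⟩, rfl⟩
    exact Set.mem_range_self n
  let U : Ultrafilter ℕ := Ultrafilter.of atTop
  have hU : (U : Filter ℕ) ≤ atTop := Ultrafilter.of_le atTop
  obtain ⟨ν, -, hν⟩ := hcomp.ultrafilter_le_nhds (U.map c) (by
    rw [le_principal_iff]
    exact mem_map.2 (univ_mem' fun n ↦ subset_closure (Set.mem_range_self n)))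
  have hlim : Tendsto c U (𝓝 ν) := hν
  refine ⟨ν, c, U, fun n ↦ rfl, hlim, ?_⟩
  have := Measure.isProbabilityMeasure_map (μ := (ν : Measure P)) hi.measurable.aemeasurable
  have := Measure.isProbabilityMeasure_map (μ := (ν : Measure P)) hig.measurable.aemeasurable
  refine ext_of_forall_integral_eq_of_IsFiniteMeasure fun f ↦ ?_
  rw [integral_map hi.measurable.aemeasurable f.continuous.measurable.aestronglyMeasurable,
    integral_map hig.measurable.aemeasurable f.continuous.measurable.aestronglyMeasurable]
  rw [ProbabilityMeasure.tendsto_iff_forall_integral_tendsto] at hlim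
  have h1 := hlim (f.compContinuous ⟨i, hi⟩)
  have h2 := hlim (f.compContinuous ⟨i ∘ g, hig⟩)
  have h3 := (tendsto_integral_cesaroMeasure_sub hg (lam := lam)
    (f.continuous.measurable.comp hi.measurable) (C := ‖f‖)
    fun x ↦ f.norm_coe_le_norm (i x)).mono_left hU
  exact sub_eq_zero.1 (tendsto_nhds_unique (h2.sub h1) h3)

/-- A limit of probability measures with constant image under a continuous map has the same
image. -/
lemma map_eq_of_tendsto {P W ι : Type*} [MeasurableSpace P] [TopologicalSpace P]
    [OpensMeasurableSpace P] [MeasurableSpace W] [TopologicalSpace W] [BorelSpace W]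
    [HasOuterApproxClosed W] {l : Filter ι} [l.NeBot] {c : ι → ProbabilityMeasure P}
    {ν : ProbabilityMeasure P} (h : Tendsto c l (𝓝 ν)) {f : P → W} (hf : Continuous f)
    {κ : Measure W} (hκ : ∀ n, (c n : Measure P).map f = κ) : (ν : Measure P).map f = κ := by
  obtain ⟨n₀⟩ : Nonempty ι := nonempty_of_neBot l
  have h1 := ProbabilityMeasure.tendsto_map_of_tendsto_of_continuous c ν h hf
  have h2 (n : ι) : (c n).map hf.measurable.aemeasurable =
      (c n₀).map hf.measurable.aemeasurable :=
    Subtype.ext ((hκ n).trans (hκ n₀).symm)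
  simp only [h2] at h1
  exact (congrArg ProbabilityMeasure.toMeasure (tendsto_nhds_unique tendsto_const_nhds h1)).symm.trans (hκ n₀)

/-- Let `lam` be a measure on `X × Z` all of whose images under the iterates of `T × R` have fixed
marginals and fixed image under `F × id`. Then some `T × R`-invariant measure has these marginals
and this image. -/
lemma exists_invariant_of_iterate {X Y Z : Type*} [MeasurableSpace X] [StandardBorelSpace X]
    [MeasurableSpace Y] [StandardBorelSpace Y] [MeasurableSpace Z] [StandardBorelSpace Z]
    {T : X → X} {R : Z → Z} {F : X → Y} (hT : Measurable T) (hR : Measurable R)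
    (hF : Measurable F) (lam : Measure (X × Z)) [IsProbabilityMeasure lam]
    {μ : Measure X} [IsFiniteMeasure μ] {κ : Measure (Y × Z)} [IsFiniteMeasure κ]
    (hfst : ∀ k, (lam.map (Prod.map T R)^[k]).map Prod.fst = μ)
    (hκ : ∀ k, (lam.map (Prod.map T R)^[k]).map (Prod.map F id) = κ) :
    ∃ ν : Measure (X × Z), IsProbabilityMeasure ν ∧ ν.map (Prod.map T R) = ν ∧
      ν.map Prod.fst = μ ∧ ν.map (Prod.map F id) = κ := by
  let _ := upgradeStandardBorel X
  let _ := upgradeStandardBorel Y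
  let _ := upgradeStandardBorel Z
  obtain ⟨X', _, _, _, _, e, he, hTF⟩ := exists_polish_refinement (hT.prodMk hF)
  obtain ⟨Z', _, _, _, _, e', he', hRe⟩ := exists_polish_refinement hR
  have hTe : Continuous (T ∘ e) := continuous_fst.comp hTF
  have hFe : Continuous (F ∘ e) := continuous_snd.comp hTF
  let i : X' × Z' ≃ᵐ X × Z := e.prodCongr e'
  have hi : Continuous i := he.prodMap he'
  let g : X × Z → X × Z := Prod.map T R
  have hg : Measurable g := hT.prodMap hR
  let g' : X' × Z' → X' × Z' := i.symm ∘ g ∘ i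
  have hg' : Measurable g' := i.symm.measurable.comp (hg.comp i.measurable)
  have hig : i ∘ g' = g ∘ i := by ext1 x; simp [g']
  have hig_cont : Continuous (i ∘ g') := by rw [hig]; exact hTe.prodMap hRe
  let lam' : Measure (X' × Z') := lam.map i.symm
  have : IsProbabilityMeasure lam' :=
    Measure.isProbabilityMeasure_map i.symm.measurable.aemeasurable
  have hsemi : Function.Semiconj i g' g := fun x ↦ congrFun hig x
  have hmap (k : ℕ) : (lam'.map g'^[k]).map i = lam.map g^[k] := by
    have h1 : i ∘ g'^[k] ∘ i.symm = g^[k] := by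
      ext1 x
      simpa using (hsemi.iterate_right k).eq (i.symm x)
    rw [Measure.map_map (hg'.iterate k) i.symm.measurable,
      Measure.map_map i.measurable ((hg'.iterate k).comp i.symm.measurable), h1]
  have hFid : Measurable (Prod.map F id : X × Z → Y × Z) := hF.prodMap measurable_id
  have hFid' : Continuous ((Prod.map F id : X × Z → Y × Z) ∘ i) := hFe.prodMap he'
  have hfst' := map_cesaroMeasure (lam := lam') (measurable_fst.comp i.measurable) fun k ↦ by
    rw [← Measure.map_map measurable_fst i.measurable, hmap, hfst k]
  have hκ' := map_cesaroMeasure (lam := lam') (hFid.comp i.measurable) fun k ↦ by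
    rw [← Measure.map_map hFid i.measurable, hmap, hκ k]
  have htight : IsTightMeasureSet (Set.range (cesaroMeasure g' lam')) := by
    refine IsTightMeasureSet.prodMk ?_ ?_
    · refine (isTightMeasureSet_singleton (μ := μ.map e.symm)).subset ?_
      rintro _ ⟨_, ⟨n, rfl⟩, rfl⟩
      rw [Set.mem_singleton_iff, ← hfst' n, Measure.map_map e.symm.measurable
        (measurable_fst.comp i.measurable), Measure.fst]
      congr 1
      ext1 x
      simp [i, MeasurableEquiv.prodCongr]
    · refine (isTightMeasureSet_singleton (μ := (κ.map Prod.snd).map e'.symm)).subset ?_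
      rintro _ ⟨_, ⟨n, rfl⟩, rfl⟩
      rw [Set.mem_singleton_iff, ← hκ' n, Measure.map_map measurable_snd
        (hFid.comp i.measurable), Measure.map_map e'.symm.measurable
        (measurable_snd.comp (hFid.comp i.measurable)), Measure.snd]
      congr 1
      ext1 x
      simp [i, MeasurableEquiv.prodCongr]
  obtain ⟨ν, c, U, hc, hlim, hinv⟩ :=
    exists_tendsto_cesaroMeasure hg' lam' hi hig_cont htight
  refine ⟨(ν : Measure (X' × Z')).map i,
    Measure.isProbabilityMeasure_map i.measurable.aemeasurable, ?_, ?_, ?_⟩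
  · rw [Measure.map_map hg i.measurable, ← hig, hinv]
  · rw [Measure.map_map measurable_fst i.measurable]
    exact map_eq_of_tendsto hlim (continuous_fst.comp hi) fun n ↦ by rw [hc, hfst']
  · rw [Measure.map_map hFid i.measurable]
    exact map_eq_of_tendsto hlim hFid' fun n ↦ by rw [hc, hκ']

/-- The relatively independent lift of a coupling along a measure-preserving map. -/
lemma exists_coupling_lift {X Y Z : Type*} [MeasurableSpace X] [MeasurableSpace Y]
    [MeasurableSpace Z] [StandardBorelSpace Z] [Nonempty Z] {μ : Measure X}
    [IsProbabilityMeasure μ] {F : X → Y} (hF : Measurable F) {κ : Measure (Y × Z)}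
    [IsFiniteMeasure κ] (h : κ.map Prod.fst = μ.map F) :
    ∃ lam : Measure (X × Z), IsProbabilityMeasure lam ∧ lam.map Prod.fst = μ ∧
      lam.map (Prod.map F id) = κ := by
  refine ⟨μ ⊗ₘ (κ.condKernel.comap F hF), inferInstance, Measure.fst_compProd _ _, ?_⟩
  conv_rhs => rw [← κ.disintegrate κ.condKernel, Measure.fst, h]
  ext s hs
  have hFid : Measurable (Prod.map F id : X × Z → Y × Z) := hF.prodMap measurable_id
  have := Measure.isProbabilityMeasure_map (μ := μ) hF.aemeasurable
  rw [Measure.map_apply hFid hs, Measure.compProd_apply (hFid hs), Measure.compProd_apply hs,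
    lintegral_map (Kernel.measurable_kernel_prodMk_left hs) hF]
  rfl

/-- A joining of a factor with a third system lifts to a joining of the extension. -/
lemma MPS.IsJoining.exists_lift {V W Q : MPS} {F : V.X → W.X}
    (hF : MeasurePreserving F V.μ W.μ)
    (hcomm : (fun x => F (V.T x)) =ᵐ[V.μ] (fun x => W.T (F x)))
    {κ : Measure (W.X × Q.X)} (hκ : W.IsJoining Q κ) :
    ∃ lam, V.IsJoining Q lam ∧ lam.map (Prod.map F id) = κ := by
  obtain ⟨_, hinv, hfst, hsnd⟩ := hκ
  have : Nonempty Q.X := nonempty_of_isProbabilityMeasure Q.μ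
  have hVT := V.mp.measurable
  have hQT := Q.mp.measurable
  have hFid : Measurable (Prod.map F id : V.X × Q.X → W.X × Q.X) :=
    hF.measurable.prodMap measurable_id
  obtain ⟨lam, _, hlam_fst, hlam⟩ :=
    exists_coupling_lift (μ := V.μ) hF.measurable (hfst.trans hF.map_eq.symm)
  have hg : Measurable (Prod.map V.T Q.T) := hVT.prodMap hQT
  have hstep (η : Measure (V.X × Q.X)) (h1 : η.map Prod.fst = V.μ)
      (h2 : η.map (Prod.map F id) = κ) :
      (η.map (Prod.map V.T Q.T)).map Prod.fst = V.μ ∧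
        (η.map (Prod.map V.T Q.T)).map (Prod.map F id) = κ := by
    constructor
    · rw [Measure.map_map measurable_fst hg, Prod.map_fst', ← Measure.map_map hVT measurable_fst,
        h1, V.mp.map_eq]
    · rw [Measure.map_map hFid hg, ← hinv.map_eq, ← h2, Measure.map_map hinv.measurable hFid]
      refine Measure.map_congr ?_
      rw [← h1] at hcomm
      filter_upwards [ae_of_ae_map measurable_fst.aemeasurable hcomm] with x hx
      exact Prod.ext hx rfl
  have hiter (k : ℕ) : (lam.map (Prod.map V.T Q.T)^[k]).map Prod.fst = V.μ ∧
      (lam.map (Prod.map V.T Q.T)^[k]).map (Prod.map F id) = κ := by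
    induction k with
    | zero => simpa using ⟨hlam_fst, hlam⟩
    | succ k ih =>
      rw [Function.iterate_succ', ← Measure.map_map hg (hg.iterate k)]
      exact hstep _ ih.1 ih.2
  obtain ⟨ν, hν, hν_inv, hν_fst, hν_κ⟩ := exists_invariant_of_iterate hVT hQT hF.measurable lam
    (fun k ↦ (hiter k).1) fun k ↦ (hiter k).2
  refine ⟨ν, ⟨hν, ⟨hg, hν_inv⟩, hν_fst, ?_⟩, hν_κ⟩
  rw [← hsnd, ← hν_κ, Measure.map_map measurable_snd hFid]
  rfl

/-- The class `A⊥` is closed under factors. -/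
lemma MPS.IsFactor.mem_perp {A : Set MPS} {V W : MPS} (h : V.IsFactor W)
    (hV : V ∈ MPS.perp A) : W ∈ MPS.perp A := by
  obtain ⟨F, hF, hcomm⟩ := h
  intro Q hQ κ hκ
  obtain ⟨lam, hlam, rfl⟩ := hκ.exists_lift hF hcomm
  rw [hV Q hQ lam hlam]
  exact (hF.prod (MeasurePreserving.id Q.μ)).map_eq

/-- For any class `A` of measure-preserving systems, the class
`M(A⊥)` of multipliers of `A⊥` is closed under taking factors: if `T ∈ M(A⊥)` and `S`
is a factor of `T`, then `S ∈ M(A⊥)`. -/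
theorem multiplier_closed_under_factors
    (A : Set MPS) (T S : MPS)
    (hT : MPS.IsMultiplier A T) (hfac : T.IsFactor S) :
    MPS.IsMultiplier A S := by
  refine ⟨hfac.mem_perp hT.1, fun Q hQ κ hκ ↦ ?_⟩
  obtain ⟨F, hF, hcomm⟩ := hfac
  obtain ⟨lam, hlam, hmap⟩ := hκ.exists_lift hF hcomm
  refine MPS.IsFactor.mem_perp (V := T.joinSys Q lam hlam) ?_ (hT.2 Q hQ lam hlam)
  refine ⟨Prod.map F id, ⟨hF.measurable.prodMap measurable_id, hmap⟩, ?_⟩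
  rw [← hlam.2.2.1] at hcomm
  filter_upwards [ae_of_ae_map measurable_fst.aemeasurable hcomm] with x hx
  exact Prod.ext hx rfl
end

section
/- If (X,μ,T) and (Y,ν,S) are both disjoint from every ergodic system, then their Cartesian product (X × Y, μ ⊗ ν, T × S) is disjoint from every ergodic system. -/
open MeasureTheory

open ProbabilityTheory Filter Set
open scoped ENNReal Topology

theorem exists_countable_isPiSystem (W : Type*) [m : MeasurableSpace W]
    [MeasurableSpace.CountablyGenerated W] :
    ∃ 𝒞 : Set (Set W), 𝒞.Countable ∧ IsPiSystem 𝒞 ∧ m = MeasurableSpace.generateFrom 𝒞 := by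
  refine ⟨generateSetAlgebra (MeasurableSpace.countableGeneratingSet W),
    countable_generateSetAlgebra MeasurableSpace.countable_countableGeneratingSet,
    fun s hs t ht _ ↦ isSetAlgebra_generateSetAlgebra.inter_mem hs ht, ?_⟩
  rw [generateFrom_generateSetAlgebra_eq, MeasurableSpace.generateFrom_countableGeneratingSet]

/-- The push-forwards under `S` of the restrictions of `ν` to the sections of a measurable set
have jointly measurable densities. No countability assumption on the spaces is needed. -/
theorem exists_measurable_density_map_restrict_section {Q Y : Type*} [MeasurableSpace Q]
    [MeasurableSpace Y] {ν : Measure Y} [IsFiniteMeasure ν] {S : Y → Y}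
    (hS : MeasurePreserving S ν ν) {D : Set (Q × Y)} (hD : MeasurableSet D) :
    ∃ h : Q × Y → ℝ≥0∞, Measurable h ∧ ∀ q B, MeasurableSet B →
      ν (S ⁻¹' B ∩ Prod.mk q ⁻¹' D) = ∫⁻ y in B, h (q, y) ∂ν := by
  induction D, hD using MeasurableSpace.induction_on_inter generateFrom_prod.symm
    isPiSystem_prod with
  | empty => exact ⟨0, measurable_zero, by simp⟩
  | basic D hD =>
    obtain ⟨J, hJ, B', hB', rfl⟩ := hD
    have hJ : MeasurableSet J := hJ
    have hac : (ν.restrict B').map S ≪ ν := by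
      conv_rhs => rw [← hS.map_eq]
      exact Measure.restrict_le_self.absolutelyContinuous.map hS.measurable
    refine ⟨fun p ↦ J.indicator 1 p.1 * ((ν.restrict B').map S).rnDeriv ν p.2,
      ((measurable_one.indicator hJ).comp measurable_fst).mul
        ((Measure.measurable_rnDeriv _ _).comp measurable_snd), fun q B hB ↦ ?_⟩
    by_cases hq : q ∈ J
    · simp only [hq, indicator_of_mem, Pi.one_apply, one_mul, mk_preimage_prod_right]
      rw [Measure.setLIntegral_rnDeriv hac, Measure.map_apply hS.measurable hB,
        Measure.restrict_apply (hS.measurable hB)]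
    · simp [hq]
  | compl D hD ih =>
    obtain ⟨h, hm, hh⟩ := ih
    have hle (q : Q) : ∀ᵐ y ∂ν, h (q, y) ≤ 1 := by
      refine ae_le_of_forall_setLIntegral_le_of_sigmaFinite (by fun_prop) fun B hB _ ↦ ?_
      rw [← hh q B hB, setLIntegral_one, ← hS.measure_preimage hB.nullMeasurableSet]
      exact measure_mono inter_subset_left
    refine ⟨fun p ↦ 1 - h p, by fun_prop, fun q B hB ↦ ?_⟩
    rw [lintegral_sub (by fun_prop) ?_ (ae_restrict_of_ae (hle q)), ← hh q B hB, setLIntegral_one,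
      ← hS.measure_preimage hB.nullMeasurableSet, preimage_compl, ← sdiff_eq,
      ← measure_inter_add_sdiff (S ⁻¹' B) (measurable_prodMk_left hD),
      ENNReal.add_sub_cancel_left (measure_ne_top _ _)]
    rw [← hh q B hB]
    exact measure_ne_top _ _
  | iUnion D hdisj hD ih =>
    choose h hm hh using ih
    refine ⟨fun p ↦ ∑' n, h n p, by fun_prop, fun q B hB ↦ ?_⟩
    rw [lintegral_tsum (fun n ↦ by fun_prop)]
    simp_rw [← hh _ q B hB]
    rw [preimage_iUnion, inter_iUnion, measure_iUnion]
    · exact fun i j hij ↦ ((hdisj hij).preimage _).mono inter_subset_right inter_subset_right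
    · exact fun n ↦ (hS.measurable hB).inter (measurable_prodMk_left (hD n))

theorem exists_measurable_density_map {Q Y : Type*} [MeasurableSpace Q]
    [MeasurableSpace Y] {ν : Measure Y} [IsFiniteMeasure ν] {S : Y → Y}
    (hS : MeasurePreserving S ν ν) {f : Q × Y → ℝ≥0∞} (hf : Measurable f) :
    ∃ h : Q × Y → ℝ≥0∞, Measurable h ∧ ∀ q B, MeasurableSet B →
      ∫⁻ y in S ⁻¹' B, f (q, y) ∂ν = ∫⁻ y in B, h (q, y) ∂ν := by
  refine Measurable.ennreal_induction (motive := fun f ↦ ∃ h : Q × Y → ℝ≥0∞, Measurable h ∧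
    ∀ q B, MeasurableSet B → ∫⁻ y in S ⁻¹' B, f (q, y) ∂ν = ∫⁻ y in B, h (q, y) ∂ν)
    (fun c D hD ↦ ?_) (fun f g _ hf hg ihf ihg ↦ ?_) (fun f hf hmono ih ↦ ?_) hf
  · obtain ⟨h, hm, hh⟩ := exists_measurable_density_map_restrict_section hS hD
    refine ⟨fun p ↦ c * h p, by fun_prop, fun q B hB ↦ ?_⟩
    rw [lintegral_const_mul c (by fun_prop), ← hh q B hB]
    have : (fun y ↦ D.indicator (fun _ ↦ c) (q, y)) = (Prod.mk q ⁻¹' D).indicator fun _ ↦ c := rfl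
    rw [this, lintegral_indicator_const (measurable_prodMk_left hD),
      Measure.restrict_apply (measurable_prodMk_left hD), inter_comm]
  · obtain ⟨h, hm, hh⟩ := ihf
    obtain ⟨k, km, hk⟩ := ihg
    refine ⟨fun p ↦ h p + k p, by fun_prop, fun q B hB ↦ ?_⟩
    simp only [Pi.add_apply]
    rw [lintegral_add_left (by fun_prop), lintegral_add_left (by fun_prop), hh q B hB, hk q B hB]
  · choose h hm hh using ih
    refine ⟨fun p ↦ ⨆ n, h n p, .iSup hm, fun q B hB ↦ ?_⟩
    rw [lintegral_iSup (fun n ↦ by fun_prop) fun m n hmn y ↦ hmono hmn (q, y),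
      lintegral_iSup_ae (fun n ↦ by fun_prop)]
    · simp_rw [hh _ q B hB]
    · refine fun n ↦ ae_restrict_of_ae <|
        ae_le_of_forall_setLIntegral_le_of_sigmaFinite (by fun_prop) fun B hB _ ↦ ?_
      rw [← hh n q B hB, ← hh _ q B hB]
      exact lintegral_mono fun y ↦ hmono n.le_succ (q, y)

theorem measurable_birkhoffAverage {W : Type*} [MeasurableSpace W] {R : W → W} (hR : Measurable R)
    {f : W → ℝ} (hf : Measurable f) (n : ℕ) : Measurable (birkhoffAverage ℝ R f n) := by
  have h (i : ℕ) : Measurable fun w ↦ f (R^[i] w) := hf.comp (hR.iterate i)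
  have : birkhoffAverage ℝ R f n = fun w ↦ (n : ℝ)⁻¹ • ∑ i ∈ Finset.range n, f (R^[i] w) := rfl
  rw [this]
  fun_prop

theorem norm_birkhoffAverage_le {W : Type*} (R : W → W) {f : W → ℝ} {K : ℝ} (hK : 0 ≤ K)
    (hf : ∀ w, ‖f w‖ ≤ K) (n : ℕ) (w : W) : ‖birkhoffAverage ℝ R f n w‖ ≤ K := by
  rw [birkhoffAverage, birkhoffSum, norm_smul, norm_inv, RCLike.norm_natCast]
  refine inv_mul_le_of_le_mul₀ n.cast_nonneg hK ?_
  simpa using norm_sum_le_of_le (Finset.range n) fun i _ ↦ hf (R^[i] w)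

theorem norm_indicator_one_le {W : Type*} (C : Set W) (w : W) :
    ‖C.indicator (1 : W → ℝ) w‖ ≤ 1 :=
  (norm_indicator_le_norm_self _ _).trans (by simp)

theorem exists_subseq_birkhoffAverage_tendsto_ae {W : Type*} [MeasurableSpace W] {ω : Measure W}
    [IsFiniteMeasure ω] {R : W → W} (hR : MeasurePreserving R ω ω) {f : W → ℝ}
    (hf : Measurable f) (hb : Bornology.IsBounded (range f)) :
    ∃ g : W → ℝ, Measurable g ∧ g ∘ R = g ∧ ∃ ns : ℕ → ℕ, StrictMono ns ∧
      ∀ᵐ w ∂ω, Tendsto (fun k ↦ birkhoffAverage ℝ R f (ns k) w) atTop (𝓝 (g w)) := by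
  obtain ⟨K, hK⟩ := isBounded_iff_forall_norm_le.1 hb
  have hfL : MemLp f 2 ω := .of_bound hf.aestronglyMeasurable K
    (ae_of_all _ fun w ↦ hK _ (mem_range_self w))
  let L := (Lp.compMeasurePreservingₗᵢ ℝ R hR : Lp ℝ 2 ω →ₗᵢ[ℝ] Lp ℝ 2 ω).toContinuousLinearMap
  have hL (x : Lp ℝ 2 ω) : L x =ᵐ[ω] x ∘ R := Lp.coeFn_compMeasurePreserving x hR
  have hiter (n : ℕ) : (L^[n] hfL.toLp : Lp ℝ 2 ω) =ᵐ[ω] f ∘ R^[n] := by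
    induction n with
    | zero => exact hfL.coeFn_toLp
    | succ n ih =>
      rw [Function.iterate_succ_apply', Function.iterate_succ]
      exact (hL _).trans (hR.quasiMeasurePreserving.ae_eq_comp ih)
  have hsum (n : ℕ) : (∑ i ∈ Finset.range n, L^[i] hfL.toLp : Lp ℝ 2 ω)
      =ᵐ[ω] fun w ↦ birkhoffSum R f n w := by
    induction n with
    | zero => simpa using! Lp.coeFn_zero ℝ 2 ω
    | succ n ih =>
      rw [Finset.sum_range_succ]
      filter_upwards [Lp.coeFn_add (∑ i ∈ Finset.range n, L^[i] hfL.toLp) (L^[n] hfL.toLp), ih,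
        hiter n] with w h1 h2 h3
      rw [h1, Pi.add_apply, h2, h3, birkhoffSum_succ, Function.comp_apply]
  have havg (n : ℕ) : (birkhoffAverage ℝ L id n hfL.toLp : Lp ℝ 2 ω)
      =ᵐ[ω] birkhoffAverage ℝ R f n := by
    filter_upwards [Lp.coeFn_smul (n : ℝ)⁻¹ (∑ i ∈ Finset.range n, L^[i] hfL.toLp), hsum n]
      with w h1 h2
    simp only [birkhoffAverage, birkhoffSum, id] at h1 h2 ⊢
    rw [h1, Pi.smul_apply, h2]
  obtain ⟨ns, hns, hlim⟩ := (tendstoInMeasure_of_tendsto_Lp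
    (L.tendsto_birkhoffAverage_orthogonalProjection (LinearIsometry.norm_toContinuousLinearMap_le _)
      hfL.toLp)).exists_seq_tendsto_ae
  set u : ℕ → W → ℝ := fun k ↦ birkhoffAverage ℝ R f (ns k)
  have hu (k : ℕ) : Measurable (u k) :=
    measurable_birkhoffAverage hR.measurable hf _
  have hsub (w : W) : Tendsto (fun k ↦ u k (R w) - u k w) atTop (𝓝 0) :=
    (tendsto_birkhoffAverage_apply_sub_birkhoffAverage' ℝ hb R w).comp hns.tendsto_atTop
  have hiff (w : W) (c : ℝ) :
      Tendsto (fun k ↦ u k (R w)) atTop (𝓝 c) ↔ Tendsto (fun k ↦ u k w) atTop (𝓝 c) :=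
    ⟨fun h ↦ by simpa using h.sub (hsub w), fun h ↦ by simpa using h.add (hsub w)⟩
  set G : Set W := {w | ∃ c, Tendsto (fun k ↦ u k w) atTop (𝓝 c)}
  have hG : MeasurableSet G := measurableSet_exists_tendsto hu
  refine ⟨G.indicator fun w ↦ limsup (fun k ↦ u k w) atTop, (Measurable.limsup hu).indicator hG,
    funext fun w ↦ ?_, ns, hns, ?_⟩
  · by_cases hw : w ∈ G
    · obtain ⟨c, hc⟩ := id hw
      have hRc := (hiff w c).2 hc
      have hRw : R w ∈ G := ⟨c, hRc⟩
      simp only [Function.comp_apply, indicator_of_mem, hw, hRw]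
      rw [hc.limsup_eq, hRc.limsup_eq]
    · have hRw : R w ∉ G := fun ⟨c, hc⟩ ↦ hw ⟨c, (hiff w c).1 hc⟩
      simp [hw, hRw]
  · filter_upwards [hlim, ae_all_iff.2 fun k ↦ havg (ns k)] with w h1 h2
    have h3 : Tendsto (fun k ↦ u k w) atTop (𝓝 _) := h1.congr h2
    have hw : w ∈ G := ⟨_, h3⟩
    rw [indicator_of_mem hw, h3.limsup_eq]
    exact h3

theorem setIntegral_birkhoffAverage_of_preimage_eq {W : Type*} [MeasurableSpace W] {η : Measure W}
    {R : W → W} (hR : MeasurePreserving R η η) {f : W → ℝ} (hf : Integrable f η)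
    {A : Set W} (hA : MeasurableSet A) (hRA : R ⁻¹' A = A) {n : ℕ} (hn : n ≠ 0) :
    ∫ w in A, birkhoffAverage ℝ R f n w ∂η = ∫ w in A, f w ∂η := by
  have hRA' : MeasurePreserving R (η.restrict A) (η.restrict A) := by
    simpa [hRA] using hR.restrict_preimage hA
  have hint (i : ℕ) : ∫ w in A, f (R^[i] w) ∂η = ∫ w in A, f w ∂η := by
    have h := hRA'.iterate i
    have := integral_map (μ := η.restrict A) h.measurable.aemeasurable (f := f)
      (by rw [h.map_eq]; exact hf.restrict.aestronglyMeasurable)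
    rw [← this, h.map_eq]
  simp only [birkhoffAverage, birkhoffSum]
  rw [integral_smul, integral_finsetSum]
  · simp [hint, hn]
  · exact fun i _ ↦ ((hRA'.iterate i).integrable_comp_of_integrable hf.restrict)

/-- If the Birkhoff averages of the indicators of the sets of a generating `π`-system converge to
constants along subsequences, then the measure is ergodic. -/
theorem Ergodic.of_birkhoffAverage_tendsto_const {W : Type*} [mW : MeasurableSpace W]
    {η : Measure W} [IsProbabilityMeasure η] {R : W → W} (hR : MeasurePreserving R η η)
    {𝒞 : Set (Set W)} (hpi : IsPiSystem 𝒞) (hgen : mW = MeasurableSpace.generateFrom 𝒞)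
    (h : ∀ C ∈ 𝒞, ∃ (c : ℝ) (ns : ℕ → ℕ), StrictMono ns ∧ ∀ᵐ w ∂η,
      Tendsto (fun k ↦ birkhoffAverage ℝ R (C.indicator 1) (ns k) w) atTop (𝓝 c)) :
    Ergodic R η := by
  refine ⟨hR, ⟨fun A hA hRA ↦ ?_⟩⟩
  have key (C : Set W) (hC : C ∈ 𝒞) : η (C ∩ A) = η A * η C := by
    have hCm : MeasurableSet C := hgen ▸ MeasurableSpace.measurableSet_generateFrom hC
    obtain ⟨c, ns, hns, hc⟩ := h C hC
    have hint : Integrable (C.indicator (1 : W → ℝ)) η := (integrable_const 1).indicator hCm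
    have hlim (B : Set W) (hB : MeasurableSet B) (hRB : R ⁻¹' B = B) :
        η.real (C ∩ B) = η.real B * c := by
      have hbd (n : ℕ) (w : W) : ‖birkhoffAverage ℝ R (C.indicator (1 : W → ℝ)) n w‖ ≤ 1 :=
        norm_birkhoffAverage_le R zero_le_one (norm_indicator_one_le C) n w
      have h1 : Tendsto
          (fun k ↦ ∫ w in B, birkhoffAverage ℝ R (C.indicator (1 : W → ℝ)) (ns k) w ∂η)
          atTop (𝓝 (∫ w in B, c ∂η)) :=
        tendsto_integral_of_dominated_convergence 1
          (fun k ↦ (measurable_birkhoffAverage hR.measurable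
            (measurable_one.indicator hCm) _).aestronglyMeasurable)
          (integrable_const 1) (fun k ↦ ae_of_all _ (hbd _)) (ae_restrict_of_ae hc)
      have h2 : Tendsto
          (fun k ↦ ∫ w in B, birkhoffAverage ℝ R (C.indicator (1 : W → ℝ)) (ns k) w ∂η)
          atTop (𝓝 (η.real (C ∩ B))) := by
        refine tendsto_const_nhds.congr' ?_
        filter_upwards [eventually_gt_atTop 0] with k hk
        rw [setIntegral_birkhoffAverage_of_preimage_eq hR hint hB hRB
          ((Nat.zero_le _).trans_lt (hns hk)).ne', integral_indicator_one hCm,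
          measureReal_restrict_apply hCm]
      rw [tendsto_nhds_unique h2 h1]
      simp
    have hc1 := hlim univ .univ rfl
    have hc2 := hlim A hA hRA
    simp only [inter_univ, probReal_univ, one_mul] at hc1
    rw [← hc1] at hc2
    rw [← ENNReal.toReal_eq_toReal_iff' (by finiteness) (by finiteness), ENNReal.toReal_mul]
    exact hc2
  have hext : η.restrict A = η A • η := by
    refine ext_of_generate_finite 𝒞 hgen hpi (fun C hC ↦ ?_) (by simp)
    rw [Measure.restrict_apply' hA, key C hC]
    rfl
  have hidem : η A = η A * η A := by
    simpa [Measure.restrict_apply' hA] using congr($hext A)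
  rw [eventuallyConst_set']
  rcases eq_or_ne (η A) 0 with h0 | h0
  · exact .inl (ae_eq_empty.2 h0)
  · right
    rw [ae_eq_univ_iff_measure_eq hA.nullMeasurableSet, measure_univ]
    exact ((ENNReal.mul_eq_left h0 (measure_ne_top _ _)).1 hidem.symm)

theorem ae_ergodic_of_compProd_eq_map {Q W : Type*} [MeasurableSpace Q] [MeasurableSpace W]
    [MeasurableSpace.CountablyGenerated W] {ω : Measure W} [IsFiniteMeasure ω] {R : W → W}
    (hR : MeasurePreserving R ω ω) {q : W → Q} (hq : Measurable q)
    (hQ : ∀ g : W → ℝ, Measurable g → g ∘ R = g → ∃ γ : Q → ℝ, Measurable γ ∧ g = γ ∘ q)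
    {E : Kernel Q W} [IsMarkovKernel E] (hE : ω.map q ⊗ₘ E = ω.map fun w ↦ (q w, w))
    (hER : ∀ᵐ a ∂(ω.map q), MeasurePreserving R (E a) (E a)) :
    ∀ᵐ a ∂(ω.map q), Ergodic R (E a) := by
  obtain ⟨𝒞, hcount, hpi, hgen⟩ := exists_countable_isPiSystem W
  have hconv : ∀ C ∈ 𝒞, ∀ᵐ a ∂(ω.map q), ∃ (c : ℝ) (ns : ℕ → ℕ), StrictMono ns ∧ ∀ᵐ w ∂(E a),
      Tendsto (fun k ↦ birkhoffAverage ℝ R (C.indicator 1) (ns k) w) atTop (𝓝 c) := by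
    intro C hC
    have hCm : MeasurableSet C := hgen ▸ MeasurableSpace.measurableSet_generateFrom hC
    obtain ⟨g, hg, hgR, ns, hns, hlim⟩ := exists_subseq_birkhoffAverage_tendsto_ae hR
      (f := C.indicator 1) (measurable_one.indicator hCm)
      (isBounded_iff_forall_norm_le.2 ⟨1, forall_mem_range.2 (norm_indicator_one_le C)⟩)
    obtain ⟨γ, hγ, rfl⟩ := hQ g hg hgR
    have hpair : Measurable fun w ↦ (q w, w) := hq.prodMk measurable_id
    have h1 : ∀ᵐ p ∂(ω.map q ⊗ₘ E), γ (q p.2) = γ p.1 := by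
      rw [hE, ae_map_iff hpair.aemeasurable (measurableSet_eq_fun (by fun_prop) (by fun_prop))]
      exact ae_of_all _ fun _ ↦ rfl
    have h2 : ∀ᵐ p ∂(ω.map q ⊗ₘ E),
        Tendsto (fun k ↦ birkhoffAverage ℝ R (C.indicator 1) (ns k) p.2) atTop (𝓝 (γ (q p.2))) := by
      have : ω = (ω.map q ⊗ₘ E).map Prod.snd := by
        rw [hE, Measure.map_map measurable_snd hpair]
        exact Measure.map_id.symm
      rw [this] at hlim
      exact ae_of_ae_map measurable_snd.aemeasurable hlim
    filter_upwards [Measure.ae_ae_of_ae_compProd h1, Measure.ae_ae_of_ae_compProd h2] with a ha1 ha2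
    refine ⟨γ a, ns, hns, ?_⟩
    filter_upwards [ha1, ha2] with w hw1 hw2
    rwa [← hw1]
  filter_upwards [hER, (ae_ball_iff hcount).2 hconv] with a ha hconv
  exact .of_birkhoffAverage_tendsto_const ha hpi hgen hconv

/-- If `κ` is the conditional law of the second coordinate of an invariant measure given a factor
`q` that the dynamics fixes pointwise and the first coordinate, then almost every conditional
measure `ν ⊗ κ (a, ·)` is invariant. -/
theorem ae_measurePreserving_const_compProd {Q Y W : Type*} [MeasurableSpace Q] [MeasurableSpace Y]
    [MeasurableSpace W] [MeasurableSpace.CountablyGenerated W] {τ : Measure Q} {ν : Measure Y}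
    [IsProbabilityMeasure τ] [IsProbabilityMeasure ν] {S : Y → Y} (hS : MeasurePreserving S ν ν)
    {R : W → W} (hR : Measurable R) {κ : Kernel (Q × Y) W} [IsMarkovKernel κ]
    (hκ : MeasurePreserving (Prod.map id (Prod.map S R)) (τ ⊗ₘ (Kernel.const Q ν ⊗ₖ κ))
      (τ ⊗ₘ (Kernel.const Q ν ⊗ₖ κ))) :
    ∀ᵐ a ∂τ, MeasurePreserving (Prod.map S R) ((Kernel.const Q ν ⊗ₖ κ) a)
      ((Kernel.const Q ν ⊗ₖ κ) a) := by
  obtain ⟨𝒞, hcount, hpi, hgen⟩ := exists_countable_isPiSystem W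
  have hrect {J : Set Q} {B : Set Y} {C : Set W} (hJ : MeasurableSet J) (hB : MeasurableSet B)
      (hC : MeasurableSet C) : (τ ⊗ₘ (Kernel.const Q ν ⊗ₖ κ)) (J ×ˢ B ×ˢ C) =
        ∫⁻ a in J, ∫⁻ y in B, κ (a, y) C ∂ν ∂τ := by
    rw [Measure.compProd_apply_prod hJ (hB.prod hC)]
    simp_rw [Kernel.compProd_apply_prod hB hC, Kernel.const_apply]
  have hC : ∀ C ∈ 𝒞, ∀ᵐ a ∂τ, ∀ B, MeasurableSet B →
      ∫⁻ y in S ⁻¹' B, κ (a, y) (R ⁻¹' C) ∂ν = ∫⁻ y in B, κ (a, y) C ∂ν := by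
    intro C hC
    have hCm : MeasurableSet C := hgen ▸ MeasurableSpace.measurableSet_generateFrom hC
    obtain ⟨h, hm, hh⟩ := exists_measurable_density_map (Q := Q) hS (κ.measurable_coe (hR hCm))
    have hκC := κ.measurable_coe hCm
    have hfin : ∫⁻ p, κ p C ∂(τ.prod ν) ≠ ∞ :=
      ((lintegral_mono fun p ↦ prob_le_one).trans_lt (by simp)).ne
    have heq : (τ.prod ν).withDensity (fun p ↦ κ p C) = (τ.prod ν).withDensity h := by
      have : IsFiniteMeasure ((τ.prod ν).withDensity fun p ↦ κ p C) :=
        isFiniteMeasure_withDensity hfin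
      refine Measure.ext_prod fun {J B} hJ hB ↦ ?_
      rw [withDensity_apply _ (hJ.prod hB), withDensity_apply _ (hJ.prod hB),
        setLIntegral_prod _ (by fun_prop), setLIntegral_prod _ (by fun_prop)]
      simp_rw [← hh _ B hB]
      rw [← hrect hJ hB hCm, ← hrect hJ (hS.measurable hB) (hR hCm),
        ← hκ.measure_preimage (hJ.prod (hB.prod hCm)).nullMeasurableSet]
      rfl
    have hae := (withDensity_eq_iff hκC.aemeasurable hm.aemeasurable hfin).1 heq
    filter_upwards [Measure.ae_ae_of_ae_prod hae] with a ha B hB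
    rw [hh a B hB]
    exact lintegral_congr_ae (ae_restrict_of_ae (ha.mono fun y hy ↦ hy.symm))
  filter_upwards [(ae_ball_iff hcount).2 hC] with a ha
  have hSR : Measurable (Prod.map S R) := hS.measurable.prodMap hR
  refine ⟨hSR, Measure.ext_prod fun {B C} hB hC ↦ ?_⟩
  have hpre : Prod.map S R ⁻¹' (B ×ˢ C) = (S ⁻¹' B) ×ˢ (R ⁻¹' C) := rfl
  set L := (Kernel.const Q ν ⊗ₖ κ) a with hLdef
  have hmap {C : Set W} (hC : MeasurableSet C) :
      (L.restrict ((S ⁻¹' B) ×ˢ univ)).map (fun p ↦ R p.2) C = L ((S ⁻¹' B) ×ˢ (R ⁻¹' C)) := by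
    have hRm : Measurable fun p : Y × W ↦ R p.2 := by fun_prop
    rw [Measure.map_apply hRm hC, Measure.restrict_apply (hRm hC)]
    congr 1
    ext; simp [and_comm]
  have hmap' {C : Set W} (hC : MeasurableSet C) :
      (L.restrict (B ×ˢ univ)).map Prod.snd C = L (B ×ˢ C) := by
    rw [Measure.map_apply measurable_snd hC, Measure.restrict_apply (measurable_snd hC)]
    congr 1
    ext; simp [and_comm]
  have hL : (L.restrict ((S ⁻¹' B) ×ˢ univ)).map (fun p ↦ R p.2) =
      (L.restrict (B ×ˢ univ)).map Prod.snd := by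
    refine ext_of_generate_finite 𝒞 hgen hpi (fun C hC ↦ ?_) ?_
    · have hCm : MeasurableSet C := hgen ▸ MeasurableSpace.measurableSet_generateFrom hC
      rw [hmap hCm, hmap' hCm, hLdef, Kernel.compProd_apply_prod (hS.measurable hB) (hR hCm),
        Kernel.compProd_apply_prod hB hCm]
      exact ha C hC B hB
    · rw [hmap .univ, hmap' .univ, hLdef, preimage_univ,
        Kernel.compProd_apply_prod (hS.measurable hB) .univ, Kernel.compProd_apply_prod hB .univ]
      simp [hS.measure_preimage hB.nullMeasurableSet]
  rw [Measure.map_apply hSR (hB.prod hC), hpre, ← hmap hC, ← hmap' hC, hL]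

theorem eq_prod_of_forall_ergodic {Y W Q : Type} {mQ : MeasurableSpace Q} [MeasurableSpace Y]
    [MeasurableSpace W] [StandardBorelSpace W] {ν : Measure Y} [IsProbabilityMeasure ν] {S : Y → Y}
    (hS : MeasurePreserving S ν ν)
    (hY : ∀ (Z : Type) [MeasurableSpace Z] (ρ : Measure Z) (R : Z → Z),
      IsProbabilityMeasure ρ → Ergodic R ρ →
      ∀ lam : Measure (Y × Z), IsProbabilityMeasure lam →
        MeasurePreserving (Prod.map S R) lam lam →
        lam.map Prod.fst = ν → lam.map Prod.snd = ρ → lam = ν.prod ρ)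
    {R : W → W} (hR : Measurable R) {lam : Measure (Y × W)} [IsProbabilityMeasure lam]
    (hlam : MeasurePreserving (Prod.map S R) lam lam) {q : W → Q} (hq : Measurable q)
    (hqR : ∀ J, MeasurableSet J → R ⁻¹' (q ⁻¹' J) = q ⁻¹' J)
    (hQ : ∀ g : W → ℝ, Measurable g → g ∘ R = g → ∃ γ : Q → ℝ, Measurable γ ∧ g = γ ∘ q)
    (hind : ∀ B J, MeasurableSet B → MeasurableSet J →
      lam (B ×ˢ (q ⁻¹' J)) = ν B * lam (univ ×ˢ (q ⁻¹' J))) :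
    lam = ν.prod (lam.map Prod.snd) := by
  have hne : Nonempty (Y × W) := nonempty_of_isProbabilityMeasure lam
  have : Nonempty W := hne.map Prod.snd
  set ω := lam.map Prod.snd
  have hω : IsProbabilityMeasure ω := Measure.isProbabilityMeasure_map (by fun_prop)
  have hτ : IsProbabilityMeasure (ω.map q) := Measure.isProbabilityMeasure_map hq.aemeasurable
  have hRω : MeasurePreserving R ω ω := by
    refine ⟨hR, ?_⟩
    change (lam.map Prod.snd).map R = lam.map Prod.snd
    rw [Measure.map_map hR measurable_snd]
    conv_rhs => rw [← hlam.map_eq, Measure.map_map measurable_snd hlam.measurable]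
    rfl
  set Λ : Measure ((Q × Y) × W) := lam.map fun p ↦ ((q p.2, p.1), p.2)
  have hΛm : Measurable fun p : Y × W ↦ ((q p.2, p.1), p.2) := by fun_prop
  have hΛfst : Λ.fst = (ω.map q).prod ν := by
    refine (Measure.prod_eq fun J B hJ hB ↦ ?_).symm
    have hpre : (Prod.fst ∘ fun p : Y × W ↦ ((q p.2, p.1), p.2)) ⁻¹' (J ×ˢ B) =
        B ×ˢ (q ⁻¹' J) := by ext; simp [and_comm]
    rw [Measure.fst, Measure.map_map measurable_fst hΛm,
      Measure.map_apply (measurable_fst.comp hΛm) (hJ.prod hB), hpre, hind B J hB hJ, mul_comm,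
      Measure.map_apply hq hJ, Measure.map_apply measurable_snd (hq hJ), univ_prod]
  have : IsProbabilityMeasure Λ := Measure.isProbabilityMeasure_map hΛm.aemeasurable
  let κ := Λ.condKernel
  let L : Kernel Q (Y × W) := Kernel.const Q ν ⊗ₖ κ
  have hL : ω.map q ⊗ₘ L = lam.map fun p ↦ (q p.2, p) := by
    have h1 : Λ = ((ω.map q).prod ν) ⊗ₘ κ := by rw [← hΛfst]; exact (Λ.disintegrate _).symm
    have : lam.map (fun p ↦ (q p.2, p)) = Λ.map MeasurableEquiv.prodAssoc := by
      rw [Measure.map_map (MeasurableEquiv.measurable _) hΛm]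
      rfl
    rw [this]
    refine Measure.ext_prod₃ fun {J B C} hJ hB hC ↦ ?_
    rw [Measure.compProd_apply_prod hJ (hB.prod hC), MeasurableEquiv.map_apply]
    have hpre : (MeasurableEquiv.prodAssoc : (Q × Y) × W ≃ᵐ _) ⁻¹' (J ×ˢ B ×ˢ C)
      = (J ×ˢ B) ×ˢ C := by ext; simp [MeasurableEquiv.prodAssoc, and_assoc]
    rw [hpre, h1, Measure.compProd_apply_prod (hJ.prod hB) hC,
      setLIntegral_prod _ (κ.measurable_coe hC).aemeasurable]
    simp_rw [L, Kernel.compProd_apply_prod hB hC, Kernel.const_apply]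
  have hLm : Measurable fun p : Y × W ↦ (q p.2, p) := by fun_prop
  have hinv : ∀ᵐ a ∂(ω.map q), MeasurePreserving (Prod.map S R) (L a) (L a) := by
    refine ae_measurePreserving_const_compProd hS hR ?_
    change MeasurePreserving _ (ω.map q ⊗ₘ L) (ω.map q ⊗ₘ L)
    have hm : Measurable (Prod.map (id : Q → Q) (Prod.map S R)) :=
      measurable_id.prodMap (hS.measurable.prodMap hR)
    refine ⟨hm, Measure.ext_prod fun {J D} hJ hD ↦ ?_⟩
    rw [Measure.map_apply hm (hJ.prod hD), hL, Measure.map_apply hLm (hm (hJ.prod hD)),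
      Measure.map_apply hLm (hJ.prod hD),
      ← hlam.measure_preimage (hLm (hJ.prod hD)).nullMeasurableSet]
    congr 1
    ext p
    have : q (R p.2) ∈ J ↔ q p.2 ∈ J := Set.ext_iff.1 (hqR J hJ) p.2
    simp [this]
  have hE : ω.map q ⊗ₘ L.snd = ω.map fun w ↦ (q w, w) := by
    have : ω.map q ⊗ₘ L.snd = (ω.map q ⊗ₘ L).map (Prod.map id Prod.snd) := by
      refine Measure.ext_prod fun {J C} hJ hC ↦ ?_
      rw [Measure.map_apply (by fun_prop) (hJ.prod hC), Measure.compProd_apply_prod hJ hC]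
      have hpre : Prod.map id Prod.snd ⁻¹' J ×ˢ C = J ×ˢ (Prod.snd ⁻¹' C : Set (Y × W)) := rfl
      rw [hpre, Measure.compProd_apply_prod hJ (measurable_snd hC)]
      simp_rw [Kernel.snd_apply' _ _ hC]
    rw [this, hL, Measure.map_map (by fun_prop) hLm, Measure.map_map (by fun_prop) measurable_snd]
    rfl
  have hLfst (a : Q) : (L a).map Prod.fst = ν := by
    have : (L.fst) a = ν := by rw [Kernel.fst_compProd, Kernel.const_apply]
    rwa [Kernel.fst_apply] at this
  have hER : ∀ᵐ a ∂(ω.map q), MeasurePreserving R (L.snd a) (L.snd a) := by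
    filter_upwards [hinv] with a ha
    refine ⟨hR, ?_⟩
    rw [Kernel.snd_apply, Measure.map_map hR measurable_snd]
    conv_rhs => rw [← ha.map_eq, Measure.map_map measurable_snd ha.measurable]
    rfl
  have herg := ae_ergodic_of_compProd_eq_map hRω hq hQ hE hER
  have hprod : ∀ᵐ a ∂(ω.map q), L a = ν.prod (L.snd a) := by
    filter_upwards [hinv, herg] with a ha1 ha2
    exact hY W (L.snd a) R inferInstance ha2 (L a) inferInstance ha1 (hLfst a)
      (Kernel.snd_apply _ _).symm
  refine (Measure.prod_eq fun B C hB hC ↦ ?_).symm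
  have h1 : lam (B ×ˢ C) = (ω.map q ⊗ₘ L) (univ ×ˢ (B ×ˢ C)) := by
    rw [hL, Measure.map_apply hLm (.prod .univ (hB.prod hC))]
    congr 1
    ext; simp
  have h2 : ω C = (ω.map q ⊗ₘ L.snd) (univ ×ˢ C) := by
    rw [hE, Measure.map_apply (by fun_prop) (.prod .univ hC)]
    congr 1
    ext; simp
  rw [h1, h2, Measure.compProd_apply_prod .univ (hB.prod hC), Measure.compProd_apply_prod .univ hC,
    ← lintegral_const_mul _ (L.snd.measurable_coe hC)]
  refine lintegral_congr_ae (ae_restrict_of_ae ?_)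
  filter_upwards [hprod] with a ha
  rw [ha, Measure.prod_prod]

/-- A joining of a system disjoint from all ergodic systems with an arbitrary system is the product
as soon as the invariant sets of the latter are independent of the former. -/
theorem eq_prod_of_invariants_indep {Y W : Type} [MeasurableSpace Y]
    [MeasurableSpace W] {ν : Measure Y} [IsProbabilityMeasure ν] {S : Y → Y}
    (hS : MeasurePreserving S ν ν)
    (hY : ∀ (Z : Type) [MeasurableSpace Z] (ρ : Measure Z) (R : Z → Z),
      IsProbabilityMeasure ρ → Ergodic R ρ →
      ∀ lam : Measure (Y × Z), IsProbabilityMeasure lam →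
        MeasurePreserving (Prod.map S R) lam lam →
        lam.map Prod.fst = ν → lam.map Prod.snd = ρ → lam = ν.prod ρ)
    {R : W → W} (hR : Measurable R) {lam : Measure (Y × W)} [IsProbabilityMeasure lam]
    (hlam : MeasurePreserving (Prod.map S R) lam lam)
    (hind : ∀ B J, MeasurableSet B → MeasurableSet J → R ⁻¹' J = J →
      lam (B ×ˢ J) = ν B * lam (univ ×ˢ J)) :
    lam = ν.prod (lam.map Prod.snd) := by
  have : IsProbabilityMeasure (lam.map Prod.snd) :=
    Measure.isProbabilityMeasure_map measurable_snd.aemeasurable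
  refine (Measure.prod_eq fun B D hB hD ↦ ?_).symm
  classical
  let shift : (ℕ → Bool) → ℕ → Bool := fun x n ↦ x (n + 1)
  have hshift : Measurable shift := by fun_prop
  let π : W → ℕ → Bool := fun w n ↦ decide (R^[n] w ∈ D)
  have hπ : Measurable π := by
    refine measurable_pi_iff.2 fun n ↦ measurable_to_bool ?_
    convert! hR.iterate n hD using 1
    ext; simp [π]
  have hπD w : π w 0 = true ↔ w ∈ D := decide_eq_true_iff
  have hπ' : Measurable (Prod.map (id : Y → Y) π) := measurable_id.prodMap hπ
  have : IsProbabilityMeasure (lam.map (Prod.map (id : Y → Y) π)) :=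
    Measure.isProbabilityMeasure_map hπ'.aemeasurable
  have key := eq_prod_of_forall_ergodic (mQ := MeasurableSpace.invariants shift) hS hY hshift
    (lam := lam.map (Prod.map id π)) (q := id) ?_ ?_ ?_ ?_ ?_
  · have h := congr($key (B ×ˢ {x | x 0 = true}))
    have hE : MeasurableSet {x : ℕ → Bool | x 0 = true} :=
      (measurable_pi_apply 0 : Measurable fun x : ℕ → Bool ↦ x 0) (measurableSet_singleton true)
    have hpre : Prod.map id π ⁻¹' (B ×ˢ {x | x 0 = true}) = B ×ˢ D := by
      ext; simp [hπD]
    rw [Measure.map_apply hπ' (hB.prod hE), hpre, Measure.prod_prod,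
      Measure.map_apply measurable_snd hE, Measure.map_apply hπ' (measurable_snd hE)] at h
    rw [h, Measure.map_apply measurable_snd hD]
    congr 2
    ext; simp [hπD]
  · have hm := hS.measurable.prodMap hshift
    refine ⟨hm, ?_⟩
    rw [Measure.map_map hm hπ']
    conv_rhs => rw [← hlam.map_eq, Measure.map_map hπ' hlam.measurable]
    rfl
  · exact fun s hs ↦ hs.1
  · exact fun J hJ ↦ hJ.2
  · exact fun g hg hgR ↦ ⟨g, MeasurableSpace.measurable_invariants_dom.2
      ⟨hg, fun s _ ↦ by rw [hgR]⟩, rfl⟩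
  · intro B J hB hJ
    rw [preimage_id, Measure.map_apply hπ' (hB.prod hJ.1), Measure.map_apply hπ' (.prod .univ hJ.1)]
    exact hind B (π ⁻¹' J) hB (hπ hJ.1) (congrArg (π ⁻¹' ·) hJ.2)

/-- If a system is disjoint from an ergodic system, then invariant sets of their product are,
up to null sets, lifted from the first factor. -/
theorem exists_ae_eq_prod_univ_of_disjoint {X Z : Type*} [MeasurableSpace X] [MeasurableSpace Z]
    {μ : Measure X} {ρ : Measure Z} [IsProbabilityMeasure μ] [IsProbabilityMeasure ρ]
    {T : X → X} {R : Z → Z} (hT : MeasurePreserving T μ μ) (hR : Ergodic R ρ)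
    (hdisj : ∀ lam : Measure (X × Z), IsProbabilityMeasure lam →
      MeasurePreserving (Prod.map T R) lam lam →
      lam.map Prod.fst = μ → lam.map Prod.snd = ρ → lam = μ.prod ρ)
    {J : Set (X × Z)} (hJ : MeasurableSet J) (hTR : Prod.map T R ⁻¹' J = J) :
    ∃ A : Set X, MeasurableSet A ∧ J =ᵐ[μ.prod ρ] A ×ˢ univ := by
  set φ : X → ℝ≥0∞ := fun x ↦ ρ (Prod.mk x ⁻¹' J)
  have hφ : Measurable φ := measurable_measure_prodMk_left hJ
  have hφ1 (x : X) : φ x ≤ 1 := prob_le_one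
  have hmem (p : X × Z) : Prod.map T R p ∈ J ↔ p ∈ J := Set.ext_iff.1 hTR p
  have hφT (x : X) : φ (T x) = φ x := by
    have hpre : R ⁻¹' (Prod.mk (T x) ⁻¹' J) = Prod.mk x ⁻¹' J := by
      ext z
      exact hmem (x, z)
    simp only [φ]
    rw [← hpre, hR.measure_preimage (measurable_prodMk_left hJ).nullMeasurableSet]
  set F : X × Z → ℝ≥0∞ := fun p ↦ J.indicator 1 p + (1 - φ p.1)
  have hF : Measurable F := (measurable_one.indicator hJ).add (by fun_prop)
  have hFinv (p : X × Z) : F (Prod.map T R p) = F p := by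
    simp only [F, Prod.map_fst, hφT]
    congr 1
    exact indicator_eq_indicator (hmem p) rfl
  have hFint (x : X) : ∫⁻ z, F (x, z) ∂ρ = 1 := by
    have h1 : (fun z ↦ J.indicator (1 : X × Z → ℝ≥0∞) (x, z)) = (Prod.mk x ⁻¹' J).indicator 1 := rfl
    simp only [F]
    rw [lintegral_add_right _ (by fun_prop), h1,
      lintegral_indicator_one (measurable_prodMk_left hJ),
      lintegral_const, measure_univ, mul_one]
    exact add_tsub_cancel_of_le (hφ1 x)
  have hprod : MeasurePreserving (Prod.map T R) (μ.prod ρ) (μ.prod ρ) :=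
    hT.prod hR.toMeasurePreserving
  set lam := (μ.prod ρ).withDensity F
  have hlam : MeasurePreserving (Prod.map T R) lam lam := by
    refine ⟨hprod.measurable, Measure.ext fun s hs ↦ ?_⟩
    rw [Measure.map_apply hprod.measurable hs, withDensity_apply _ (hprod.measurable hs),
      withDensity_apply _ hs, ← hprod.setLIntegral_comp_preimage hs hF]
    simp_rw [hFinv]
  have hfst : lam.map Prod.fst = μ := by
    refine Measure.ext fun s hs ↦ ?_
    rw [Measure.map_apply measurable_fst hs, withDensity_apply _ (measurable_fst hs), ← prod_univ,
      setLIntegral_prod _ hF.aemeasurable]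
    simp [hFint]
  have hlamp : IsProbabilityMeasure lam := by
    refine ⟨?_⟩
    rw [← preimage_univ (f := Prod.fst), ← Measure.map_apply measurable_fst .univ, hfst,
      measure_univ]
  have hsnd : lam.map Prod.snd = ρ := by
    have : IsProbabilityMeasure (lam.map Prod.snd) :=
      Measure.isProbabilityMeasure_map measurable_snd.aemeasurable
    refine hR.eq_of_absolutelyContinuous ⟨hR.measurable, ?_⟩ ?_
    · rw [Measure.map_map hR.measurable measurable_snd]
      conv_rhs => rw [← hlam.map_eq, Measure.map_map measurable_snd hlam.measurable]
      rfl
    · have := (withDensity_absolutelyContinuous (μ.prod ρ) F).map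
        (measurable_snd : Measurable (Prod.snd : X × Z → Z))
      rwa [Measure.map_snd_prod, measure_univ, one_smul] at this
  have hone : F =ᵐ[μ.prod ρ] 1 := by
    have heq : (μ.prod ρ).withDensity 1 = (μ.prod ρ).withDensity F := by
      rw [withDensity_one]
      exact (hdisj lam hlamp hlam hfst hsnd).symm
    exact ((withDensity_eq_iff measurable_one.aemeasurable hF.aemeasurable (by simp)).1 heq).symm
  refine ⟨{x | φ x ≠ 0}, hφ (measurableSet_singleton 0).compl, ?_⟩
  filter_upwards [hone] with p hp
  refine propext (?_ : p ∈ J ↔ p ∈ {x | φ x ≠ 0} ×ˢ univ)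
  by_cases hpJ : p ∈ J
  · simp only [F, hpJ, indicator_of_mem, Pi.one_apply] at hp
    have : 1 - φ p.1 = 0 := by
      simpa using (ENNReal.add_right_inj ENNReal.one_ne_top).1 (hp.trans (add_zero 1).symm)
    have h0 : φ p.1 ≠ 0 := fun h ↦ by simp [h] at this
    simp [hpJ, h0]
  · simp only [F, hpJ, not_false_eq_true, indicator_of_notMem, Pi.one_apply, zero_add] at hp
    have h0 : φ p.1 = 0 := by
      have := ENNReal.sub_sub_cancel ENNReal.one_ne_top (hφ1 p.1)
      rw [← this, hp, tsub_self]
    simp [hpJ, h0]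

/-- If `(X, μ, T)` and `(Y, ν, S)` are both disjoint from every
ergodic system, then their Cartesian product `(X × Y, μ ⊗ ν, T × S)` is disjoint from
every ergodic system: the class `Erg⊥` is closed under Cartesian products. -/
theorem erg_perp_closed_under_products
    {X Y : Type} [MeasurableSpace X] [MeasurableSpace Y]
    (μ : Measure X) (ν : Measure Y)
    [IsProbabilityMeasure μ] [IsProbabilityMeasure ν]
    (T : X → X) (S : Y → Y)
    (hT : MeasurePreserving T μ μ) (hS : MeasurePreserving S ν ν)
    (hX : ∀ (Z : Type) [MeasurableSpace Z] (ρ : Measure Z) (R : Z → Z),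
      IsProbabilityMeasure ρ → Ergodic R ρ →
      ∀ lam : Measure (X × Z), IsProbabilityMeasure lam →
        MeasurePreserving (Prod.map T R) lam lam →
        lam.map Prod.fst = μ → lam.map Prod.snd = ρ → lam = μ.prod ρ)
    (hY : ∀ (Z : Type) [MeasurableSpace Z] (ρ : Measure Z) (R : Z → Z),
      IsProbabilityMeasure ρ → Ergodic R ρ →
      ∀ lam : Measure (Y × Z), IsProbabilityMeasure lam →
        MeasurePreserving (Prod.map S R) lam lam →
        lam.map Prod.fst = ν → lam.map Prod.snd = ρ → lam = ν.prod ρ) :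
    ∀ (Z : Type) [MeasurableSpace Z] (ρ : Measure Z) (R : Z → Z),
      IsProbabilityMeasure ρ → Ergodic R ρ →
      ∀ lam : Measure ((X × Y) × Z), IsProbabilityMeasure lam →
        MeasurePreserving (Prod.map (Prod.map T S) R) lam lam →
        lam.map Prod.fst = μ.prod ν → lam.map Prod.snd = ρ →
        lam = (μ.prod ν).prod ρ := by
  intro Z _ ρ R hρ hR lam hlam hinv hfst hsnd
  have hmXZ : Measurable fun p : (X × Y) × Z ↦ (p.1.1, p.2) := by fun_prop
  have hmYXZ : Measurable fun p : (X × Y) × Z ↦ (p.1.2, (p.1.1, p.2)) := by fun_prop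
  have hXY {A : Set X} {B : Set Y} (hA : MeasurableSet A) (hB : MeasurableSet B) :
      lam ((A ×ˢ B) ×ˢ univ) = μ A * ν B := by
    rw [prod_univ, ← Measure.map_apply measurable_fst (hA.prod hB), hfst, Measure.prod_prod]
  have hXZ : lam.map (fun p ↦ (p.1.1, p.2)) = μ.prod ρ := by
    refine hX Z ρ R hρ hR _ (Measure.isProbabilityMeasure_map hmXZ.aemeasurable) ?_ ?_ ?_
    · have hm := hT.measurable.prodMap hR.measurable
      refine ⟨hm, ?_⟩
      rw [Measure.map_map hm hmXZ]
      conv_rhs => rw [← hinv.map_eq, Measure.map_map hmXZ hinv.measurable]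
      rfl
    · have : μ = (lam.map Prod.fst).map Prod.fst := by
        rw [hfst, Measure.map_fst_prod, measure_univ, one_smul]
      rw [this, Measure.map_map measurable_fst hmXZ, Measure.map_map measurable_fst measurable_fst]
      rfl
    · rw [← hsnd, Measure.map_map measurable_snd hmXZ]
      rfl
  set lam' : Measure (Y × X × Z) := lam.map fun p ↦ (p.1.2, (p.1.1, p.2))
  have : IsProbabilityMeasure lam' := Measure.isProbabilityMeasure_map hmYXZ.aemeasurable
  have hsnd' : lam'.map Prod.snd = μ.prod ρ := by
    rw [← hXZ, Measure.map_map measurable_snd hmYXZ]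
    rfl
  have hm := hT.measurable.prodMap hR.measurable
  have hinv' : MeasurePreserving (Prod.map S (Prod.map T R)) lam' lam' := by
    refine ⟨hS.measurable.prodMap hm, ?_⟩
    change (lam.map fun p ↦ (p.1.2, (p.1.1, p.2))).map _ = lam.map fun p ↦ (p.1.2, (p.1.1, p.2))
    rw [Measure.map_map (hS.measurable.prodMap hm) hmYXZ]
    conv_rhs => rw [← hinv.map_eq, Measure.map_map hmYXZ hinv.measurable]
    rfl
  have key : lam' = ν.prod (lam'.map Prod.snd) := by
    refine eq_prod_of_invariants_indep hS hY hm hinv' fun B J hB hJ hTR ↦ ?_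
    obtain ⟨A, hA, hJA⟩ := exists_ae_eq_prod_univ_of_disjoint hT hR (hX Z ρ R hρ hR) hJ hTR
    rw [← hsnd'] at hJA
    have hJA' := ae_eq_comp measurable_snd.aemeasurable hJA
    have hrect {B : Set Y} (hB : MeasurableSet B) : lam' (B ×ˢ J) = μ A * ν B := by
      have h1 : (B ×ˢ J : Set (Y × X × Z)) =ᵐ[lam'] B ×ˢ (A ×ˢ univ) := by
        filter_upwards [hJA'] with p hp
        have hp : (p.2 ∈ J) = (p.2 ∈ A ×ˢ univ) := hp
        exact congrArg (p.1 ∈ B ∧ ·) hp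
      rw [measure_congr h1, Measure.map_apply hmYXZ (hB.prod (hA.prod .univ)), ← hXY hA hB]
      congr 1
      ext; simp [and_comm]
    rw [hrect hB, hrect .univ, measure_univ, mul_one, mul_comm]
  refine Measure.ext_prod₃' fun {A B C} hA hB hC ↦ ?_
  have hpre : (A ×ˢ B) ×ˢ C = (fun p : (X × Y) × Z ↦ (p.1.2, (p.1.1, p.2))) ⁻¹'
      (B ×ˢ (A ×ˢ C)) := by
    ext; simp [and_left_comm, and_assoc]
  rw [hpre, ← Measure.map_apply hmYXZ (hB.prod (hA.prod hC))]
  change lam' _ = _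
  rw [key, hsnd', ← hpre]
  simp only [Measure.prod_prod]
  ring
end
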